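/- Let R be a finite valuation ring with uniformizer z, nilpotency degree r, and residue field of odd cardinality q. Let G be a subgroup of the unit group R^*, let g, h : G → R^* be functions, and let K be a positive integer such that: (i) for every fixed z₀ ∈ G, the quotient g(x·z₀)·g(x)^{-1} takes at most K distinct values as x ranges over G, and likewise h(x·z₀)·h(x)^{-1} takes at most K distinct values; and (ii) for every u ∈ G, μ(x ↦ g(x)·h(u·x)·x) ≤ K. Define f(x,y) = g(x)·h(y)·(x+y). Then for all nonempty sets A, B, C ⊆ G, one has |f(A,B)| · |A·C| · |B·C| ≥ (1/(8r·K^3)) · min{ q^r·|A|·|B| , |A|^2·|B|^2·|C| / q^{2r-1} }. -/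

import Mathlib

open Pointwise

section aux
open Finset

lemma aux_n_swap {R : Type*} [CommRing R] [Fintype R] [DecidableEq R] (p p' : R × R) :
    #{l : R × R | p.2 = l.1 * p.1 + l.2 ∧ p'.2 = l.1 * p'.1 + l.2}
      = #{m : R | m * (p'.1 - p.1) = p'.2 - p.2} := by
  refine Finset.card_bij (fun l _ => l.1) ?_ ?_ ?_
  · intro l hl
    simp only [mem_filter, mem_univ, true_and] at hl ⊢
    rw [hl.1, hl.2]; ring
  · rintro ⟨m, b⟩ hl ⟨m', b'⟩ hl' e
    simp only [mem_filter, mem_univ, true_and] at hl hl' e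
    subst e
    have : m * p.1 + b = m * p.1 + b' := by rw [← hl.1, ← hl'.1]
    simpa using this
  · intro m hm
    simp only [mem_filter, mem_univ, true_and] at hm
    refine ⟨(m, p.2 - m * p.1), ?_, rfl⟩
    simp only [mem_filter, mem_univ, true_and]
    constructor
    · ring
    · linear_combination -hm

lemma aux_row {R : Type*} [CommRing R] [Fintype R] [DecidableEq R] (P : Finset (R × R))
    (p : R × R) :
    ∑ p' ∈ P, #{m : R | m * (p'.1 - p.1) = p'.2 - p.2}
      ≤ #P + Fintype.card R * Nat.card {x : R // ¬ IsUnit x} := by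
  classical
  have h1 : ∀ p' ∈ P, #{m : R | m * (p'.1 - p.1) = p'.2 - p.2} ≤
      1 + (if IsUnit (p'.1 - p.1) then 0 else #{m : R | m * (p'.1 - p.1) = p'.2 - p.2}) := by
    intro p' _
    split_ifs with hu
    · rw [add_zero, Finset.card_le_one]
      intro a ha b hb
      simp only [mem_filter, mem_univ, true_and] at ha hb
      exact hu.mul_right_cancel (ha.trans hb.symm)
    · omega
  refine (Finset.sum_le_sum h1).trans ?_
  rw [Finset.sum_add_distrib, Finset.sum_const, smul_eq_mul, mul_one]
  gcongr
  refine (Finset.sum_le_sum_of_subset (Finset.subset_univ P)).trans ?_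
  rw [← Equiv.sum_comp (Equiv.addRight p)]
  simp only [Equiv.coe_addRight, Prod.fst_add, Prod.snd_add, add_sub_cancel_right]
  rw [Fintype.sum_prod_type]
  have h2 : ∀ d : R, ∑ e : R, (if IsUnit d then 0 else #{m : R | m * d = e})
      = if IsUnit d then 0 else Fintype.card R := by
    intro d
    split_ifs with hu
    · simp
    · rw [← Finset.card_univ]
      exact (Finset.card_eq_sum_card_fiberwise (fun x _ => Finset.mem_coe.2 (mem_univ _))).symm
  rw [Finset.sum_congr rfl (fun d _ => h2 d)]
  rw [Nat.card_eq_fintype_card, Fintype.card_subtype, mul_comm]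
  simp [Finset.sum_ite]

lemma aux_incidence {R : Type*} [CommRing R] [Fintype R] [DecidableEq R]
    (P L : Finset (R × R)) :
    ((∑ l ∈ L, #{p ∈ P | p.2 = l.1 * p.1 + l.2} : ℕ) - (#P : ℝ) * #L / Fintype.card R) ^ 2
      ≤ #P * #L * (Fintype.card R * Nat.card {x : R // ¬ IsUnit x}) := by
  classical
  have : Nonempty R := ⟨0⟩
  set Q : ℝ := (Fintype.card R : ℝ) with hQ
  have hQ0 : 0 < Q := by rw [hQ]; exact_mod_cast Fintype.card_pos
  set M : ℝ := (Nat.card {x : R // ¬ IsUnit x} : ℝ) with hM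
  set c : R × R → ℕ := fun l => #{p ∈ P | p.2 = l.1 * p.1 + l.2} with hc
  have e1 : ((∑ l ∈ L, c l : ℕ) : ℝ) - (#P : ℝ) * #L / Q
      = ∑ l ∈ L, ((c l : ℝ) - #P / Q) := by
    rw [Finset.sum_sub_distrib]; push_cast; simp; ring
  have e2 : ∑ l : R × R, c l = #P * Fintype.card R := by
    simp only [hc, Finset.card_filter]
    rw [Finset.sum_comm, Finset.sum_const_nat (m := Fintype.card R)]
    intro p _
    rw [← Finset.card_filter, ← Finset.card_univ]
    refine Finset.card_bij (fun l _ => l.1) (by simp) ?_ ?_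
    · rintro ⟨m, b⟩ hl ⟨m', b'⟩ hl' e
      simp only [mem_filter, mem_univ, true_and] at hl hl' e
      subst e
      have : m * p.1 + b = m * p.1 + b' := by rw [← hl, ← hl']
      simpa using this
    · intro m _
      exact ⟨(m, p.2 - m * p.1), by simp, rfl⟩
  have e3 : ∑ l : R × R, c l ^ 2
      ≤ #P * (#P + Fintype.card R * Nat.card {x : R // ¬ IsUnit x}) := by
    have : ∑ l : R × R, c l ^ 2
        = ∑ p ∈ P, ∑ p' ∈ P, #{m : R | m * (p'.1 - p.1) = p'.2 - p.2} := by
      simp only [← aux_n_swap]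
      simp only [hc, Finset.card_filter, sq, Finset.sum_mul_sum]
      rw [Finset.sum_comm]
      refine Finset.sum_congr rfl fun p _ => ?_
      rw [Finset.sum_comm]
      refine Finset.sum_congr rfl fun p' _ => ?_
      refine Finset.sum_congr rfl fun l _ => ?_
      split_ifs <;> simp_all
    rw [this]
    refine (Finset.sum_le_card_nsmul _ _ _ fun p _ => aux_row P p).trans ?_
    simp
  have e2' : ∑ l : R × R, (c l : ℝ) = #P * Q := by rw [hQ]; exact_mod_cast e2
  have e3' : ∑ l : R × R, (c l : ℝ) ^ 2 ≤ #P * (#P + Q * M) := by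
    rw [hQ, hM]; exact_mod_cast e3
  have e4 : ∑ l : R × R, ((c l : ℝ) - #P / Q) ^ 2 ≤ #P * (Q * M) := by
    have : ∑ l : R × R, ((c l : ℝ) - #P / Q) ^ 2
        = ∑ l : R × R, (c l : ℝ) ^ 2 - (2 * (#P / Q)) * ∑ l : R × R, (c l : ℝ)
          + Q * Q * (#P / Q) ^ 2 := by
      simp only [sub_sq, Finset.sum_add_distrib, Finset.sum_sub_distrib, Finset.mul_sum]
      congr 1
      · congr 1
        refine Finset.sum_congr rfl fun l _ => by ring
      · simp [hQ]
    rw [this, e2']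
    have h5 : 2 * (#P / Q) * (#P * Q) = 2 * (#P : ℝ) ^ 2 := by field_simp
    have h6 : Q * Q * (#P / Q) ^ 2 = (#P : ℝ) ^ 2 := by field_simp
    rw [h5, h6]
    nlinarith
  rw [e1]
  calc (∑ l ∈ L, ((c l : ℝ) - #P / Q)) ^ 2
      ≤ #L * ∑ l ∈ L, ((c l : ℝ) - #P / Q) ^ 2 := sq_sum_le_card_mul_sum_sq
    _ ≤ #L * ∑ l : R × R, ((c l : ℝ) - #P / Q) ^ 2 := by
        gcongr
        exact Finset.subset_univ _
    _ ≤ #L * (#P * (Q * M)) := by gcongr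
    _ = _ := by ring

end aux

lemma aux_card_max {R : Type*} [CommRing R] [Fintype R] [IsLocalRing R] :
    Nat.card R = Nat.card (IsLocalRing.ResidueField R)
      * Nat.card (IsLocalRing.maximalIdeal R) :=
  AddSubgroup.card_eq_card_quotient_mul_card_addSubgroup
    (IsLocalRing.maximalIdeal R).toAddSubgroup

lemma aux_step {R : Type*} [CommRing R] [Fintype R] [IsLocalRing R]
    (z : R) (hz : IsLocalRing.maximalIdeal R = Ideal.span {z}) (k : ℕ) (hk : z ^ k ≠ 0) :
    Nat.card (Ideal.span {z ^ k}) = Nat.card (IsLocalRing.ResidueField R)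
      * Nat.card (Ideal.span {z ^ (k + 1)}) := by
  set m := (IsLocalRing.maximalIdeal R).toAddSubgroup with hm
  let f : R →+ R := AddMonoidHom.mulRight (z ^ k)
  have hker : f.ker ≤ m := by
    intro a ha
    have ha' : a * z ^ k = 0 := ha
    change a ∈ IsLocalRing.maximalIdeal R
    rw [IsLocalRing.mem_maximalIdeal, mem_nonunits_iff]
    intro hu
    exact hk ((hu.mul_right_eq_zero).1 ha')
  have h1 : (Ideal.span {z ^ k}).toAddSubgroup = AddSubgroup.map f ⊤ := by
    ext x
    change x ∈ Ideal.span {z ^ k} ↔ _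
    rw [Ideal.mem_span_singleton', AddSubgroup.mem_map]
    simp [f]
  have h2 : (Ideal.span {z ^ (k + 1)}).toAddSubgroup = AddSubgroup.map f m := by
    ext x
    change x ∈ Ideal.span {z ^ (k + 1)} ↔ _
    rw [Ideal.mem_span_singleton', AddSubgroup.mem_map]
    constructor
    · rintro ⟨a, rfl⟩
      refine ⟨a * z, ?_, ?_⟩
      · change a * z ∈ IsLocalRing.maximalIdeal R
        rw [hz, Ideal.mem_span_singleton']; exact ⟨a, rfl⟩
      · simp [f]; ring
    · rintro ⟨y, hy, rfl⟩
      change y ∈ IsLocalRing.maximalIdeal R at hy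
      rw [hz, Ideal.mem_span_singleton'] at hy
      obtain ⟨a, rfl⟩ := hy
      exact ⟨a, by simp [f]; ring⟩
  have h3 : (AddSubgroup.map f m).relIndex (AddSubgroup.map f ⊤) = m.index := by
    rw [AddSubgroup.relIndex_map_map, sup_eq_left.2 hker]
    simp
  have h4 := AddSubgroup.relIndex_mul_relIndex ⊥ (AddSubgroup.map f m) (AddSubgroup.map f ⊤)
    bot_le (AddSubgroup.map_mono le_top)
  rw [AddSubgroup.relIndex_bot_left, AddSubgroup.relIndex_bot_left, h3, ← h1, ← h2] at h4
  rw [mul_comm]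
  exact h4.symm

lemma aux_card {R : Type*} [CommRing R] [Fintype R] [IsLocalRing R]
    (z : R) (hz : IsLocalRing.maximalIdeal R = Ideal.span {z})
    (r : ℕ) (hzr : z ^ r = 0) (hmin : ∀ k < r, z ^ k ≠ 0) :
    Nat.card R = Nat.card (IsLocalRing.ResidueField R) ^ r := by
  have key : ∀ k ≤ r, Nat.card R
      = Nat.card (IsLocalRing.ResidueField R) ^ k * Nat.card (Ideal.span {z ^ k}) := by
    intro k
    induction k with
    | zero =>
      intro _
      rw [pow_zero, pow_zero, one_mul, Ideal.span_singleton_one]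
      exact (Nat.card_congr (Equiv.Set.univ R)).symm
    | succ k ih =>
      intro hk
      rw [ih (by omega), aux_step z hz k (hmin k (by omega)), ← mul_assoc, ← pow_succ]
  have := key r le_rfl
  rw [this, hzr]
  simp


section count
open Finset

lemma aux_count {R : Type*} [CommRing R] [Fintype R] [DecidableEq R]
    (G : Subgroup Rˣ) (g h : G → Rˣ) (K : ℕ)
    (hgq : ∀ z₀ : G, Nat.card (Set.range fun x : G => g (x * z₀) * (g x)⁻¹) ≤ K)
    (hmu : ∀ u : G, ∀ t : Rˣ, Nat.card {x : G // g x * h (u * x) * (x : Rˣ) = t} ≤ K)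
    (A B C X Y : Finset G) (V : Finset R)
    (hX : ∀ a ∈ A, ∀ c ∈ C, a * c ∈ X) (hY : ∀ b ∈ B, ∀ c ∈ C, b * c ∈ Y)
    (hV : ∀ a ∈ A, ∀ b ∈ B,
      (g a : R) * (h b : R) * (((a : Rˣ) : R) + ((b : Rˣ) : R)) ∈ V) :
    ∃ P L : Finset (R × R), #P ≤ #V * #X ∧ #L ≤ K * (#Y * #C) ∧
      #A * #B * #C ≤ K * ∑ l ∈ L, #{p ∈ P | p.2 = l.1 * p.1 + l.2} := by
  classical
  let S : G → Finset Rˣ := fun c => Finset.univ.image fun x : G => g (x * c⁻¹) * (g x)⁻¹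
  have hS : ∀ c, #(S c) ≤ K := by
    intro c
    refine le_trans (le_of_eq ?_) (hgq c⁻¹)
    rw [Nat.card_eq_card_toFinset]
    congr 1
    ext; simp [S]
  let P : Finset (R × R) := (V ×ˢ X).image fun w => (w.1 * ((g w.2)⁻¹ : Rˣ), ((w.2 : Rˣ) : R))
  let L : Finset (R × R) := (Y ×ˢ C).biUnion fun w => (S w.2).image fun κ =>
    ((((w.2 : Rˣ) * (κ * h (w.1 * w.2⁻¹))⁻¹ : Rˣ) : R), -((w.1 : Rˣ) : R))
  refine ⟨P, L, ?_, ?_, ?_⟩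
  · exact Finset.card_image_le.trans (Finset.card_product _ _).le
  · refine (Finset.card_biUnion_le_card_mul _ _ K ?_).trans ?_
    · intro w _
      exact Finset.card_image_le.trans (hS _)
    · rw [Finset.card_product, mul_comm]
  · have hI : ∑ l ∈ L, #{p ∈ P | p.2 = l.1 * p.1 + l.2}
        = #{w ∈ P ×ˢ L | w.1.2 = w.2.1 * w.1.1 + w.2.2} := by
      rw [Finset.card_filter, Finset.sum_product_right]
      simp only [Finset.card_filter]
    rw [hI, mul_assoc, ← Finset.card_product, ← Finset.card_product]
    let F : G × G × G → (R × R) × (R × R) := fun w =>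
      (((g w.1 : R) * (h w.2.1 : R) * (((w.1 : Rˣ) : R) + ((w.2.1 : Rˣ) : R))
          * ((g (w.1 * w.2.2))⁻¹ : Rˣ), (((w.1 * w.2.2 : G) : Rˣ) : R)),
        (((((w.2.2 : G) : Rˣ) * (g w.1 * (g (w.1 * w.2.2))⁻¹ * h w.2.1)⁻¹ : Rˣ) : R),
          -(((w.2.1 * w.2.2 : G) : Rˣ) : R)))
    refine Finset.card_le_mul_card_image_of_maps_to (f := F) ?_ K ?_
    · rintro ⟨a, b, c⟩ hw
      simp only [mem_product] at hw
      obtain ⟨ha, hb, hc⟩ := hw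
      rw [mem_filter, mem_product]
      refine ⟨⟨?_, ?_⟩, ?_⟩
      · exact mem_image.2 ⟨(_, a * c), mem_product.2 ⟨hV a ha b hb, hX a ha c hc⟩, rfl⟩
      · refine mem_biUnion.2 ⟨(b * c, c), mem_product.2 ⟨hY b hb c hc, hc⟩, ?_⟩
        refine mem_image.2 ⟨g a * (g (a * c))⁻¹, ?_, ?_⟩
        · exact mem_image.2 ⟨a * c, mem_univ _, by simp⟩
        · simp [F]
      · have h1 : (((g (a * c))⁻¹ : Rˣ) : R) * (g (a * c) : R) = 1 := Units.inv_mul _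
        have h2 : (((g a)⁻¹ : Rˣ) : R) * (g a : R) = 1 := Units.inv_mul _
        have h3 : (((h b)⁻¹ : Rˣ) : R) * (h b : R) = 1 := Units.inv_mul _
        simp only [F, mul_inv, inv_inv, Units.val_mul, Subgroup.coe_mul]
        generalize (((g (a * c))⁻¹ : Rˣ) : R) = u1 at *
        generalize (((g a)⁻¹ : Rˣ) : R) = u2 at *
        generalize (((h b)⁻¹ : Rˣ) : R) = u3 at *
        generalize (g (a * c) : R) = v1 at *
        generalize (g a : R) = v2 at *
        generalize (h b : R) = v3 at *
        generalize ((a : Rˣ) : R) = a at *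
        generalize ((b : Rˣ) : R) = b at *
        generalize ((c : Rˣ) : R) = c at *
        have : c * (u2 * v1 * u3) * (v2 * v3 * (a + b) * u1)
          = c * (a + b) * (u1 * v1) * (u2 * v2) * (u3 * v3) := by ring
        rw [this, h1, h2, h3]; ring
    · intro y _
      by_cases hne : ({w ∈ A ×ˢ B ×ˢ C | F w = y} : Finset _).Nonempty
      swap
      · rw [Finset.not_nonempty_iff_eq_empty.1 hne]; simp
      obtain ⟨⟨a0, b0, c0⟩, hw0⟩ := hne
      have hy := (mem_filter.1 hw0).2
      have hF : ∀ a b c, F (a, b, c) = y → a * c = a0 * c0 ∧ b * c = b0 * c0 ∧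
          (c : Rˣ) * (g a * h b)⁻¹ = (c0 : Rˣ) * (g a0 * h b0)⁻¹ := by
        intro a b c e
        have e' := e.trans hy.symm
        simp only [F, Prod.mk.injEq, neg_inj] at e'
        obtain ⟨⟨_, e1⟩, e2, e3⟩ := e'
        have e1 : a * c = a0 * c0 := Subtype.ext (Units.ext e1)
        have e3 : b * c = b0 * c0 := Subtype.ext (Units.ext e3)
        have e2 := Units.ext e2
        refine ⟨e1, e3, ?_⟩
        rw [e1] at e2
        have e4 : ∀ (p q s t : Rˣ), t * (p * q⁻¹ * s)⁻¹ = t * (p * s)⁻¹ * q := by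
          intro p q s t
          simp only [mul_inv, inv_inv]
          ac_rfl
        rw [e4, e4] at e2
        exact mul_right_cancel e2
      refine le_trans ?_ (hmu (b0 * a0⁻¹) (g a0 * h b0 * (a0 : Rˣ)))
      rw [Nat.card_eq_fintype_card, Fintype.card_subtype]
      refine Finset.card_le_card_of_injOn (fun w => w.1) ?_ ?_
      · rintro ⟨a, b, c⟩ hw
        obtain ⟨e1, e2, e3⟩ := hF a b c (mem_filter.1 (Finset.mem_coe.1 hw)).2
        have hb : b0 * a0⁻¹ * a = b := by
          have hc : c = a0 * c0 * a⁻¹ := by rw [← e1]; simp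
          have h5 : b = b0 * c0 * c⁻¹ := by rw [← e2]; simp
          rw [h5, hc]
          simp only [mul_inv, inv_inv]
          have : b0 * c0 * (a0⁻¹ * c0⁻¹ * a) = b0 * a0⁻¹ * a * (c0 * c0⁻¹) := by ac_rfl
          rw [this]; simp
        simp only [coe_filter, mem_univ, true_and, Set.mem_setOf_eq]
        rw [hb]
        have e1' : (a : Rˣ) * c = a0 * c0 := congrArg Subtype.val e1
        have e5 : (c : Rˣ) * (g a0 * h b0) = c0 * (g a * h b) := by
          have := congrArg (fun t => t * (g a * h b) * (g a0 * h b0)) e3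
          simp only [inv_mul_cancel_right] at this
          rw [this]
          have : (c0 : Rˣ) * (g a0 * h b0)⁻¹ * (g a * h b) * (g a0 * h b0)
            = (c0 : Rˣ) * (g a * h b) * ((g a0 * h b0)⁻¹ * (g a0 * h b0)) := by ac_rfl
          rw [this]; simp
        apply mul_right_cancel (b := (c : Rˣ))
        calc g a * h b * a * c = g a * h b * (a * c) := by rw [mul_assoc]
          _ = (c0 * (g a * h b)) * a0 := by rw [e1']; ac_rfl
          _ = _ := by rw [← e5]; ac_rfl
      · rintro ⟨a, b, c⟩ hw ⟨a', b', c'⟩ hw' e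
        obtain ⟨e1, e2, e3⟩ := hF a b c (mem_filter.1 (Finset.mem_coe.1 hw)).2
        obtain ⟨e1', e2', e3'⟩ := hF a' b' c' (mem_filter.1 (Finset.mem_coe.1 hw')).2
        simp only at e
        subst e
        have hc : c = c' := mul_left_cancel (e1.trans e1'.symm)
        subst hc
        have hb : b = b' := mul_right_cancel (e2.trans e2'.symm)
        subst hb
        rfl

end count


lemma aux_final (q r K a b c v x y p l I : ℕ) (hq : 0 < q) (hr : 1 ≤ r) (hK : 0 < K)
    (ha : 0 < a) (hb : 0 < b) (hc : 0 < c) (hP : p ≤ v * x) (hL : l ≤ K * (y * c))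
    (hN : a * b * c ≤ K * I)
    (hinc : ((I : ℝ) - p * l / ((q ^ r : ℕ) : ℝ)) ^ 2
      ≤ p * l * (((q ^ r : ℕ) : ℝ) * ((q ^ (r - 1) : ℕ) : ℝ))) :
    (v : ℝ) * x * y ≥ 1 / (8 * (r : ℝ) * (K : ℝ) ^ 3) *
        min ((q : ℝ) ^ r * a * b) ((a : ℝ) ^ 2 * (b : ℝ) ^ 2 * c / (q : ℝ) ^ (2 * r - 1)) := by
  have hD : ((q ^ r : ℕ) : ℝ) * ((q ^ (r - 1) : ℕ) : ℝ) = (q : ℝ) ^ (2 * r - 1) := by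
    push_cast
    rw [← pow_add]; congr 1; omega
  rw [hD] at hinc
  push_cast at hinc
  have hDpos : (0 : ℝ) < (q : ℝ) ^ (2 * r - 1) := by positivity
  have hQpos : (0 : ℝ) < (q : ℝ) ^ r := by positivity
  generalize (q : ℝ) ^ (2 * r - 1) = D at *
  generalize (q : ℝ) ^ r = Q at *
  have hpl : (p : ℝ) * l ≤ K * (v * x * y) * c := by
    have : p * l ≤ (v * x) * (K * (y * c)) := Nat.mul_le_mul hP hL
    have : ((p * l : ℕ) : ℝ) ≤ ((v * x) * (K * (y * c)) : ℕ) := by exact_mod_cast this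
    push_cast at this
    linarith
  have hN' : (a : ℝ) * b * c ≤ K * I := by exact_mod_cast hN
  have ha' : (0 : ℝ) < a := by exact_mod_cast ha
  have hb' : (0 : ℝ) < b := by exact_mod_cast hb
  have hc' : (0 : ℝ) < c := by exact_mod_cast hc
  have hK' : (1 : ℝ) ≤ K := by exact_mod_cast hK
  have hr' : (1 : ℝ) ≤ r := by exact_mod_cast hr
  have hW : (0 : ℝ) ≤ (v : ℝ) * x * y := by positivity
  have hI : (0 : ℝ) ≤ (I : ℝ) := by positivity
  generalize (v : ℝ) * x * y = W at *
  generalize (p : ℝ) * l = T at *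
  generalize (a : ℝ) = a at *
  generalize (b : ℝ) = b at *
  generalize (c : ℝ) = c at *
  generalize (K : ℝ) = K at *
  generalize (r : ℝ) = r at *
  generalize (I : ℝ) = I at *
  have hKp : 0 < K := by linarith
  have hrp : 0 < r := by linarith
  rw [ge_iff_le, one_div, inv_mul_le_iff₀ (by positivity)]
  rcases le_total (I / 2) (T / Q) with hcase | hcase
  · refine (min_le_left _ _).trans ?_
    have h1 : I * Q ≤ 2 * T := by
      rw [div_le_div_iff₀ (by norm_num) hQpos] at hcase
      linarith
    have h2 : (Q * a * b) * c ≤ (2 * K ^ 2 * W) * c := by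
      calc (Q * a * b) * c = (a * b * c) * Q := by ring
        _ ≤ K * I * Q := by gcongr
        _ = K * (I * Q) := by ring
        _ ≤ K * (2 * T) := by gcongr
        _ ≤ K * (2 * (K * W * c)) := by gcongr
        _ = _ := by ring
    refine (le_of_mul_le_mul_right h2 hc').trans ?_
    have h3 : 2 * K ^ 2 ≤ 8 * r * K ^ 3 := by
      have : K ^ 2 * 1 ≤ K ^ 2 * (r * K) := by
        gcongr
        nlinarith
      nlinarith [sq_nonneg K]
    gcongr
  · refine (min_le_right _ _).trans ?_
    rw [div_le_iff₀ hDpos]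
    have h0 : I / 2 ≤ I - T / Q := by linarith
    have h1 : (I / 2) ^ 2 ≤ T * D := (pow_le_pow_left₀ (by linarith) h0 2).trans hinc
    have h2 : (a ^ 2 * b ^ 2 * c) * c ≤ (4 * K ^ 3 * W * D) * c := by
      calc (a ^ 2 * b ^ 2 * c) * c = (a * b * c) ^ 2 := by ring
        _ ≤ (K * I) ^ 2 := by gcongr
        _ = 4 * K ^ 2 * (I / 2) ^ 2 := by ring
        _ ≤ 4 * K ^ 2 * (T * D) := by gcongr
        _ ≤ 4 * K ^ 2 * ((K * W * c) * D) := by gcongr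
        _ = _ := by ring
    refine (le_of_mul_le_mul_right h2 hc').trans ?_
    have h3 : 4 * K ^ 3 ≤ 8 * r * K ^ 3 := by
      gcongr
      linarith
    gcongr

/-- **Theorem 1.12.**  Let `R` be a finite valuation ring with uniformizer `z`, nilpotency
degree `r`, residue field of odd cardinality `q`, `G ≤ Rˣ`, `g h : G → Rˣ` such that for
each fixed `z₀ ∈ G` the functions `x ↦ g (x z₀) / g x` and `x ↦ h (x z₀) / h x` take at
most `K` values, and `μ(x ↦ g x * h (u x) * x) ≤ K` for every `u ∈ G`.  With
`f (x, y) = g x * h y * (x + y)`, for all nonempty `A, B, C ⊆ G`,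
`|f(A,B)| * |A⬝C| * |B⬝C| ≥ (1/(8rK³)) * min (qʳ|A||B|) (|A|²|B|²|C|/q^{2r-1})`. -/
theorem stmt_4 {R : Type*} [CommRing R] [Fintype R] [IsLocalRing R] [IsPrincipalIdealRing R]
    (z : R) (hz : IsLocalRing.maximalIdeal R = Ideal.span {z})
    (r : ℕ) (hzr : z ^ r = 0) (hmin : ∀ k < r, z ^ k ≠ 0)
    (q : ℕ) (hq : Nat.card (IsLocalRing.ResidueField R) = q) (hqodd : Odd q)
    (G : Subgroup Rˣ) (g h : G → Rˣ) (K : ℕ) (hKpos : 0 < K)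
    (hgq : ∀ z₀ : G, Nat.card (Set.range fun x : G => g (x * z₀) * (g x)⁻¹) ≤ K)
    (hhq : ∀ z₀ : G, Nat.card (Set.range fun x : G => h (x * z₀) * (h x)⁻¹) ≤ K)
    (hmu : ∀ u : G, ∀ t : Rˣ, Nat.card {x : G // g x * h (u * x) * (x : Rˣ) = t} ≤ K)
    (A B C : Set G) (hA : A.Nonempty) (hB : B.Nonempty) (hC : C.Nonempty) :
    (Nat.card (Set.image2
          (fun (x y : G) => (g x : R) * (h y : R) * (((x : Rˣ) : R) + ((y : Rˣ) : R))) A B) : ℝ)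
        * (Nat.card ↥((A * C : Set G)) : ℝ) * (Nat.card ↥((B * C : Set G)) : ℝ) ≥
      1 / (8 * (r : ℝ) * (K : ℝ) ^ 3) *
        min ((q : ℝ) ^ r * (Nat.card A : ℝ) * (Nat.card B : ℝ))
          ((Nat.card A : ℝ) ^ 2 * (Nat.card B : ℝ) ^ 2 * (Nat.card C : ℝ)
            / (q : ℝ) ^ (2 * r - 1)) := by
  classical
  have hr : 1 ≤ r := by
    by_contra hr
    have : r = 0 := by omega
    rw [this, pow_zero] at hzr
    exact one_ne_zero hzr
  have hcard := aux_card z hz r hzr hmin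
  have hmax := aux_card_max (R := R)
  rw [hq] at hcard hmax
  have hQpos : 0 < Nat.card R := Nat.card_pos
  have hqpos : 0 < q := by
    rcases Nat.eq_zero_or_pos q with h0 | h0
    · rw [h0, zero_mul] at hmax; omega
    · exact h0
  have hM : Nat.card {x : R // ¬ IsUnit x} = q ^ (r - 1) := by
    have h1 : Nat.card {x : R // ¬ IsUnit x} = Nat.card (IsLocalRing.maximalIdeal R) :=
      Nat.card_congr (Equiv.subtypeEquivRight fun x => by
        rw [IsLocalRing.mem_maximalIdeal, mem_nonunits_iff])
    rw [h1]
    apply Nat.eq_of_mul_eq_mul_left hqpos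
    rw [← hmax, hcard, ← pow_succ', Nat.sub_add_cancel hr]
  obtain ⟨P, L, hP, hL, hN⟩ := aux_count G g h K hgq hmu A.toFinset B.toFinset C.toFinset
    (A * C : Set G).toFinset (B * C : Set G).toFinset
    (Set.image2 (fun (x y : G) =>
      (g x : R) * (h y : R) * (((x : Rˣ) : R) + ((y : Rˣ) : R))) A B).toFinset
    (by
      intro a ha c hc
      rw [Set.mem_toFinset] at *
      exact Set.mul_mem_mul ha hc)
    (by
      intro a ha c hc
      rw [Set.mem_toFinset] at *
      exact Set.mul_mem_mul ha hc)
    (by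
      intro a ha c hc
      rw [Set.mem_toFinset] at *
      exact Set.mem_image2_of_mem ha hc)
  have hinc := aux_incidence P L
  rw [← Nat.card_eq_fintype_card, hcard, hM] at hinc
  rw [← Nat.card_eq_card_toFinset, ← Nat.card_eq_card_toFinset] at hP hL
  simp only [← Nat.card_eq_card_toFinset] at hN
  have hApos : 0 < Nat.card A := by
    have := hA.to_subtype
    exact Nat.card_pos
  have hBpos : 0 < Nat.card B := by
    have := hB.to_subtype
    exact Nat.card_pos
  have hCpos : 0 < Nat.card C := by
    have := hC.to_subtype
    exact Nat.card_pos
  generalize (∑ l ∈ L, (P.filter fun p => p.2 = l.1 * p.1 + l.2).card) = I at hN hinc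
  generalize P.card = p at *
  generalize L.card = l at *
  generalize Nat.card (Set.image2 (fun (x y : G) =>
      (g x : R) * (h y : R) * (((x : Rˣ) : R) + ((y : Rˣ) : R))) A B) = v at *
  generalize Nat.card ↥((A * C : Set G)) = x at *
  generalize Nat.card ↥((B * C : Set G)) = y at *
  generalize Nat.card A = a at *
  generalize Nat.card B = b at *
  generalize Nat.card C = c at *
  clear hcard hmax hQpos hM
  exact aux_final q r K a b c v x y p l I hqpos hr hKpos hApos hBpos hCpos hP hL hN hinc
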